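/- Let ε ∈ ℚ with 0 < ε < 2, let m be an integer with m > 3 and m > 3/ε, let a_1 ≤ a_2 ≤ ⋯ ≤ a_m be integers with 0 ≤ a_i ≤ 2(m−1) for all i and Σ_{i=1}^m a_i = m(m−1), and let p be a positive integer. Set D = ⌊(2+ε)m⌋·p + 3m and z = D + m + 1. Define v1* = (1+ε)·⌊((1+ε)(D+1) + a_1 − D − m)/(1+ε)⌋, v2* = ⌈(1+ε)(D+1) + a_1 − D − m − v1*⌉, F* = v1* + v2* + 2(D+m), and for 1 ≤ i ≤ m, v1_i = (1+ε)(D+i) and v2_i = ⌊F* − v1_i − a_i⌋. Suppose there exist bijections t_1, t_2 from the candidate set {c_1, …, c_{z−1}, c*} to {0, 1, …, z−1} such that for every 1 ≤ i ≤ m, v1_i + v2_i + t_1(c_i) + t_2(c_i) ≤ v1* + v2* + t_1(c*) + t_2(c*). Then there exist bijections p_1, p_2 : {1, …, m} → {0, 1, …, m−1} with p_1(j) + p_2(j) = a_j for all j. -/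

import Mathlib

/-- A set of naturals exceeds the initial segment of the same size, in sum, by at least the number
of its elements outside that segment. -/
theorem Finset.sum_range_add_card_sdiff_le_sum (S : Finset ℕ) :
    ∑ i ∈ Finset.range S.card, i + (S \ Finset.range S.card).card ≤ ∑ i ∈ S, i := by
  set R := Finset.range S.card with hR
  have hcard : (R \ S).card = (S \ R).card :=
    Finset.card_sdiff_comm (by simp [hR])
  have hS := Finset.sum_inter_add_sum_sdiff S R (fun i => i)
  have hR' := Finset.sum_inter_add_sum_sdiff R S (fun i => i)
  rw [Finset.inter_comm] at hR'
  have hlow : (S \ R).card * S.card ≤ ∑ i ∈ S \ R, i := by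
    rw [← smul_eq_mul]
    refine Finset.card_nsmul_le_sum _ _ _ fun x hx => ?_
    simpa [hR] using (Finset.mem_sdiff.1 hx).2
  have hupp : ∑ i ∈ R \ S, (i + 1) ≤ (R \ S).card * S.card := by
    rw [← smul_eq_mul]
    refine Finset.sum_le_card_nsmul _ _ _ fun x hx => ?_
    simpa [hR, Nat.succ_le_iff] using (Finset.mem_sdiff.1 hx).1
  rw [Finset.sum_add_distrib, hcard] at hupp
  simp only [Finset.sum_const, smul_eq_mul, mul_one, hcard] at hupp
  omega

/-- An injective family of naturals has sum at least that of the initial segment. -/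
theorem Set.InjOn.sum_range_card_le {ι : Type*} {s : Finset ι} {f : ι → ℕ}
    (hf : Set.InjOn f s) : ∑ i ∈ Finset.range s.card, i ≤ ∑ i ∈ s, f i := by
  have h := Finset.sum_range_add_card_sdiff_le_sum (s.image f)
  rw [Finset.card_image_of_injOn hf, Finset.sum_image hf] at h
  omega

/-- An injective family of naturals of minimal sum enumerates the initial segment. -/
theorem Set.InjOn.image_eq_range_of_sum_le {ι : Type*} {s : Finset ι} {f : ι → ℕ}
    (hf : Set.InjOn f s) (hsum : ∑ i ∈ s, f i ≤ ∑ i ∈ Finset.range s.card, i) :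
    s.image f = Finset.range s.card := by
  have h := Finset.sum_range_add_card_sdiff_le_sum (s.image f)
  rw [Finset.card_image_of_injOn hf, Finset.sum_image hf] at h
  have h0 : (s.image f \ Finset.range s.card).card = 0 := by omega
  rw [Finset.card_eq_zero, Finset.sdiff_eq_empty_iff_subset] at h0
  exact Finset.eq_of_subset_of_card_le h0 (by simp [Finset.card_image_of_injOn hf])


/-- Only-if direction of the reduction for weight `w = 1 + ε` with `0 < ε < 2`
(Lemma 8 of the paper). Candidates are indexed by `{0, …, z−1}` with
`z = D + m + 1`, `D = ⌊(2+ε)m⌋·p + 3m`: candidate `c_i` (for `1 ≤ i ≤ m`) is index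
`i − 1` and the distinguished candidate `c*` is index `z − 1`. The manipulators'
votes `t1, t2` are bijections from the candidate indices `{0, …, z−1}` onto the
scores `{0, …, z−1}`. If the manipulators can make every `c_i` score at most `c*`'s
total, then the restricted 2NMTS instance `a_1 ≤ ⋯ ≤ a_m` has a solution, i.e.,
there are bijections `p1, p2 : {1,…,m} → {0,…,m−1}` with `p1(j) + p2(j) = a_j`. -/
theorem weight_one_plus_eps_only_if (ε : ℚ) (hε0 : 0 < ε) (hε2 : ε < 2)
    (m : ℕ) (hm3 : 3 < m) (hmε : 3 / ε < (m : ℚ))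
    (a : ℕ → ℤ)
    (hmono : ∀ i j, 1 ≤ i → i ≤ j → j ≤ m → a i ≤ a j)
    (hlb : ∀ i, 1 ≤ i → i ≤ m → 0 ≤ a i)
    (hub : ∀ i, 1 ≤ i → i ≤ m → a i ≤ 2 * ((m : ℤ) - 1))
    (hsum : ∑ i ∈ Finset.Icc 1 m, a i = (m : ℤ) * ((m : ℤ) - 1))
    (p : ℕ) (hp : 1 ≤ p)
    (D : ℤ) (hD : D = ⌊(2 + ε) * (m : ℚ)⌋ * (p : ℤ) + 3 * (m : ℤ))
    (z : ℕ) (hz : (z : ℤ) = D + (m : ℤ) + 1)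
    (v1star v2star Fstar : ℚ)
    (hv1s : v1star = (1 + ε) *
      (⌊((1 + ε) * ((D : ℚ) + 1) + (a 1 : ℚ) - (D : ℚ) - (m : ℚ)) / (1 + ε)⌋ : ℚ))
    (hv2s : v2star =
      (⌈(1 + ε) * ((D : ℚ) + 1) + (a 1 : ℚ) - (D : ℚ) - (m : ℚ) - v1star⌉ : ℚ))
    (hFs : Fstar = v1star + v2star + 2 * ((D : ℚ) + (m : ℚ)))
    (v1 v2 : ℕ → ℚ)
    (hv1 : ∀ i, v1 i = (1 + ε) * ((D : ℚ) + (i : ℚ)))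
    (hv2 : ∀ i, v2 i = (⌊Fstar - v1 i - (a i : ℚ)⌋ : ℚ))
    (t1 t2 : ℕ → ℕ)
    (ht1 : Set.BijOn t1 (Set.Iio z) (Set.Iio z))
    (ht2 : Set.BijOn t2 (Set.Iio z) (Set.Iio z))
    (hman : ∀ i, 1 ≤ i → i ≤ m →
      v1 i + v2 i + (t1 (i - 1) : ℚ) + (t2 (i - 1) : ℚ) ≤
        v1star + v2star + (t1 (z - 1) : ℚ) + (t2 (z - 1) : ℚ)) :
    ∃ p1 p2 : ℕ → ℕ, Set.BijOn p1 (Set.Icc 1 m) (Set.Iio m) ∧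
      Set.BijOn p2 (Set.Icc 1 m) (Set.Iio m) ∧
      ∀ j, 1 ≤ j → j ≤ m → (p1 j : ℤ) + (p2 j : ℤ) = a j := by
  have hD0 : 0 ≤ D := by
    have h1 : (0 : ℤ) ≤ ⌊(2 + ε) * (m : ℚ)⌋ := Int.floor_nonneg.2 (by positivity)
    rw [hD]
    positivity
  have hle : ∀ i, 1 ≤ i → i ≤ m → (t1 (i - 1) : ℤ) + t2 (i - 1) ≤ a i := by
    intro i hi him
    have h1 : t1 (z - 1) < z := ht1.mapsTo (Set.mem_Iio.2 (by omega))
    have h2 : t2 (z - 1) < z := ht2.mapsTo (Set.mem_Iio.2 (by omega))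
    have h3 : (t1 (z - 1) : ℤ) + t2 (z - 1) ≤ 2 * (D + m) := by omega
    have h4 : (t1 (z - 1) : ℚ) + t2 (z - 1) ≤ 2 * (D + m) := by exact_mod_cast h3
    have h5 := hman i hi him
    have h6 := Int.lt_floor_add_one (Fstar - v1 i - (a i : ℚ))
    rw [← hv2] at h6
    have h7 : (t1 (i - 1) : ℚ) + t2 (i - 1) < a i + 1 := by linarith
    have h8 : (t1 (i - 1) : ℤ) + t2 (i - 1) < a i + 1 := by exact_mod_cast h7
    omega
  have hinj : ∀ t : ℕ → ℕ, Set.BijOn t (Set.Iio z) (Set.Iio z) →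
      Set.InjOn (fun i => t (i - 1)) (Finset.Icc 1 m : Finset ℕ) := by
    intro t ht x hx y hy hxy
    simp only [Finset.coe_Icc, Set.mem_Icc] at hx hy
    have := ht.injOn (Set.mem_Iio.2 (by omega)) (Set.mem_Iio.2 (by omega)) hxy
    omega
  have hmin1 := (hinj t1 ht1).sum_range_card_le
  have hmin2 := (hinj t2 ht2).sum_range_card_le
  have hgauss := Finset.sum_range_id_mul_two m
  have hgauss' : (∑ i ∈ Finset.range m, (i : ℤ)) * 2 = m * (m - 1) := by
    have h := congrArg (Nat.cast : ℕ → ℤ) hgauss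
    rw [Nat.cast_mul, Nat.cast_mul, Nat.cast_sub (by omega)] at h
    push_cast at h
    exact h
  have hsumle : ∑ i ∈ Finset.Icc 1 m, ((t1 (i - 1) : ℤ) + t2 (i - 1)) ≤
      ∑ i ∈ Finset.Icc 1 m, a i :=
    Finset.sum_le_sum fun i hi => hle i (Finset.mem_Icc.1 hi).1 (Finset.mem_Icc.1 hi).2
  have hsplit := Finset.sum_add_distrib (s := Finset.Icc 1 m)
    (f := fun i => (t1 (i - 1) : ℤ)) (g := fun i => (t2 (i - 1) : ℤ))
  have hcard : (Finset.Icc 1 m).card = m := by simp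
  rw [hcard] at hmin1 hmin2
  zify at hmin1 hmin2
  have hbij : ∀ t : ℕ → ℕ, Set.BijOn t (Set.Iio z) (Set.Iio z) →
      ∑ i ∈ Finset.Icc 1 m, (t (i - 1) : ℤ) ≤ ∑ i ∈ Finset.range m, (i : ℤ) →
      Set.BijOn (fun i => t (i - 1)) (Set.Icc 1 m) (Set.Iio m) := by
    intro t ht hts
    have himg := (hinj t ht).image_eq_range_of_sum_le (by rw [hcard]; zify; exact hts)
    have h := (hinj t ht).bijOn_image
    rw [← Finset.coe_image, himg, hcard] at h
    simpa using h
  refine ⟨fun i => t1 (i - 1), fun i => t2 (i - 1), hbij t1 ht1 (by linarith),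
    hbij t2 ht2 (by linarith), fun j hj hjm => ?_⟩
  exact (Finset.sum_eq_sum_iff_of_le fun i hi =>
    hle i (Finset.mem_Icc.1 hi).1 (Finset.mem_Icc.1 hi).2).1 (by linarith) j
    (Finset.mem_Icc.2 ⟨hj, hjm⟩)
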